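/- arXiv:2107.00503 — 3 statements merged into one kernel-verified Lean document; each statement's English description precedes it below -/
import Mathlib

section
/- Two lattices L and L' in K^d satisfy End_{O_K}(L) = End_{O_K}(L') if and only if L and L' are equivalent, i.e., L' = p^n L for some n ∈ ℤ. -/
set_option synthInstance.maxHeartbeats 400000
set_option maxHeartbeats 1600000

open scoped Pointwise

/-- The valuation ring `O_K` of a (surjective discrete) additive valuation on `K`. -/
def valRing {K : Type*} [Field K] (v : AddValuation K (WithTop ℤ)) : Subring K where
  carrier := {x | 0 ≤ v x}
  zero_mem' := by simp only [Set.mem_setOf_eq, v.map_zero]; exact le_top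
  one_mem' := by simp only [Set.mem_setOf_eq, v.map_one, le_refl]
  add_mem' := fun {a b} ha hb => v.map_le_add ha hb
  mul_mem' := fun {a b} ha hb => by
    simp only [Set.mem_setOf_eq, v.map_mul] at *
    exact add_nonneg ha hb
  neg_mem' := fun {a} ha => by simpa only [Set.mem_setOf_eq, v.map_neg] using ha

/-- `End_{O_K}(L) = {X ∈ K^{d×d} : X L ⊆ L}` as a set of matrices. -/
def endSet {K : Type*} [Field K] {d : ℕ} (L : Set (Fin d → K)) :
    Set (Matrix (Fin d) (Fin d) K) :=
  {X | ∀ x ∈ L, X.mulVec x ∈ L}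

/-- A lattice in `K^d`: a free `O_K`-submodule of rank `d`. -/
def isLattice {K : Type*} [Field K] (v : AddValuation K (WithTop ℤ)) {d : ℕ}
    (L : Submodule (valRing v) (Fin d → K)) : Prop :=
  Module.Free (valRing v) L ∧ Module.rank (valRing v) L = (d : Cardinal)

/-- `K` is the field of fractions of its valuation ring. -/
theorem isFractionRing_valRing {K : Type*} [Field K] (v : AddValuation K (WithTop ℤ)) :
    IsFractionRing (valRing v) K := by
  refine IsFractionRing.of_field (valRing v) K fun z => ?_
  by_cases hz : 0 ≤ v z
  · exact ⟨⟨z, hz⟩, 1, by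
      rw [map_one, div_one]
      rfl⟩
  · have hz0 : z ≠ 0 := by
      rintro rfl
      exact hz (by simp)
    have hinv : 0 ≤ v z⁻¹ := by
      have h : v z + v z⁻¹ = 0 := by rw [← v.map_mul, mul_inv_cancel₀ hz0, v.map_one]
      generalize v z = a at h hz
      generalize v z⁻¹ = b at h ⊢
      cases a with
      | top => simp at hz
      | coe a =>
        cases b with
        | top => simp
        | coe b =>
          norm_cast at h hz ⊢
          omega
    exact ⟨1, ⟨z⁻¹, hinv⟩, by
      rw [map_one, one_div]
      exact (inv_inv z).symm⟩

/-- A lattice is the set of vectors with integral coordinates in some basis of `K^d`. -/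
theorem isLattice.exists_basis {K : Type*} [Field K] {v : AddValuation K (WithTop ℤ)} {d : ℕ}
    {L : Submodule (valRing v) (Fin d → K)} (hL : isLattice v L) :
    ∃ e : Module.Basis (Fin d) K (Fin d → K), ∀ x, x ∈ L ↔ ∀ i, 0 ≤ v (e.repr x i) := by
  obtain ⟨hfree, hrank⟩ := hL
  have hfin : Module.Finite (valRing v) L := Module.finite_of_rank_eq_nat hrank
  have := isFractionRing_valRing v
  let b : Module.Basis (Fin d) (valRing v) L :=
    Module.finBasisOfFinrankEq _ _ (Module.finrank_eq_of_rank_eq hrank)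
  have hli : LinearIndependent K fun i => (b i : Fin d → K) :=
    (LinearIndependent.iff_fractionRing (valRing v) K).mp
      (b.linearIndependent.map' L.subtype L.ker_subtype)
  let e : Module.Basis (Fin d) K (Fin d → K) :=
    basisOfLinearIndependentOfCardEqFinrank' _ hli (by simp)
  have he (i) : e i = b i := by simp [e]
  refine ⟨e, fun x => ⟨fun hx i => ?_, fun hx => ?_⟩⟩
  · have hsum : x = ∑ j, (b.repr ⟨x, hx⟩ j : K) • e j := by
      have h := congrArg (L.subtype) (b.sum_repr ⟨x, hx⟩)
      simp only [map_sum, map_smul, Submodule.subtype_apply] at h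
      simp only [he]
      exact h.symm
    have hi : e.repr x i = (b.repr ⟨x, hx⟩ i : K) := by
      conv_lhs => rw [hsum]
      rw [e.repr_sum_self]
    rw [hi]
    exact (b.repr ⟨x, hx⟩ i).2
  · rw [← e.sum_repr x]
    refine L.sum_mem fun i _ => ?_
    rw [he]
    exact L.smul_mem (⟨e.repr x i, hx i⟩ : valRing v) (b i).2

theorem AddValuation.map_zpow_of_eq_one {K : Type*} [Field K] (v : AddValuation K (WithTop ℤ))
    {p : K} (hp : v p = 1) (n : ℤ) : v (p ^ n) = n := by
  have hp0 : p ≠ 0 := by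
    rintro rfl
    simp at hp
  have hnat (k : ℕ) : v (p ^ k) = ((k : ℤ) : WithTop ℤ) := by
    rw [v.map_pow, hp, nsmul_one]
    rfl
  obtain ⟨k, rfl | rfl⟩ := n.eq_nat_or_neg
  · rw [zpow_natCast, hnat]
  · have h : v (p ^ (-(k : ℤ))) + v (p ^ k) = 0 := by
      rw [← v.map_mul, zpow_neg, zpow_natCast, inv_mul_cancel₀ (pow_ne_zero _ hp0), v.map_one]
    rw [hnat] at h
    generalize v (p ^ (-(k : ℤ))) = w at h ⊢
    cases w with
    | top => simp at h
    | coe w =>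
      norm_cast at h ⊢
      omega

theorem AddValuation.le_map_inv_zpow_mul_iff {K : Type*} [Field K]
    (v : AddValuation K (WithTop ℤ)) {p : K} (hp : v p = 1) (n : ℤ) (x : K) :
    0 ≤ v ((p ^ n)⁻¹ * x) ↔ (n : WithTop ℤ) ≤ v x := by
  rw [← zpow_neg, v.map_mul, v.map_zpow_of_eq_one hp]
  generalize v x = w
  cases w with
  | top => simp
  | coe w =>
    norm_cast
    omega

theorem endSet_smul {K : Type*} [Field K] {d : ℕ} {c : K} (hc : c ≠ 0) (L : Set (Fin d → K)) :
    endSet (c • L) = endSet L := by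
  ext X
  refine ⟨fun h x hx => ?_, ?_⟩
  · have := h (c • x) (Set.smul_mem_smul_set hx)
    rwa [Matrix.mulVec_smul, Set.smul_mem_smul_set_iff₀ hc] at this
  · rintro h _ ⟨x, hx, rfl⟩
    simp only [Matrix.mulVec_smul]
    exact Set.smul_mem_smul_set (h x hx)

/-- Two lattices `L, L'` in `K^d` have the same endomorphism ring
if and only if they are equivalent, i.e. `L' = p^n L` for some `n ∈ ℤ`. -/
theorem end_eq_end_iff_equivalent {K : Type*} [Field K]
    (v : AddValuation K (WithTop ℤ)) (hv : Function.Surjective v)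
    (p : K) (hp : v p = (1 : WithTop ℤ))
    (d : ℕ) (hd : 0 < d)
    (L L' : Submodule (valRing v) (Fin d → K))
    (hL : isLattice v L) (hL' : isLattice v L') :
    endSet (L : Set (Fin d → K)) = endSet (L' : Set (Fin d → K)) ↔
      ∃ n : ℤ, (L' : Set (Fin d → K)) = p ^ n • (L : Set (Fin d → K)) := by
  have hp0 : p ≠ 0 := by
    rintro rfl
    simp at hp
  refine ⟨fun h => ?_, ?_⟩
  swap
  · rintro ⟨n, hn⟩
    rw [hn, endSet_smul (zpow_ne_zero n hp0)]
  obtain ⟨e, he⟩ := hL.exists_basis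
  obtain ⟨e', he'⟩ := hL'.exists_basis
  have : Nonempty (Fin d) := ⟨⟨0, hd⟩⟩
  obtain ⟨⟨i, j⟩, hmin⟩ :=
    Finite.exists_min fun ij : Fin d × Fin d => v (e.repr (e' ij.2) ij.1)
  simp only [Prod.forall] at hmin
  set c := e.repr (e' j) i with hc
  have hc0 : c ≠ 0 := by
    intro h0
    refine e'.ne_zero j (e.repr.map_eq_zero_iff.mp (Finsupp.ext fun k => ?_))
    have hk := hmin k j
    rw [h0, v.map_zero, top_le_iff] at hk
    exact v.top_iff.mp hk
  obtain ⟨n, hn⟩ := WithTop.ne_top_iff_exists.mp (mt v.top_iff.mp hc0)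
  have hmem (y : Fin d → K) :
      y ∈ p ^ n • (L : Set (Fin d → K)) ↔ ∀ k, (n : WithTop ℤ) ≤ v (e.repr y k) := by
    rw [Set.mem_smul_set_iff_inv_smul_mem₀ (zpow_ne_zero n hp0), SetLike.mem_coe, he]
    simp only [map_smul, Finsupp.smul_apply, smul_eq_mul, v.le_map_inv_zpow_mul_iff hp]
  refine ⟨n, Set.ext fun y => ?_⟩
  rw [hmem]
  refine ⟨fun hy k => ?_, fun hy => ?_⟩
  · rw [← e'.sum_repr y]
    simp only [map_sum, map_smul, Finsupp.finsetSum_apply, Finsupp.smul_apply, smul_eq_mul]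
    refine v.map_le_sum fun l _ => ?_
    rw [v.map_mul]
    exact (hn.le.trans (hmin k l)).trans (le_add_of_nonneg_left ((he' y).mp hy l))
  · -- The endomorphism `x ↦ (x i / c) y` preserves `L` and sends `e' j` to `y`.
    let f : (Fin d → K) →ₗ[K] (Fin d → K) := (e.coord i).smulRight (c⁻¹ • y)
    have hf : LinearMap.toMatrix' f ∈ endSet (L : Set (Fin d → K)) := by
      intro x hx
      rw [LinearMap.toMatrix'_mulVec, SetLike.mem_coe, he]
      intro k
      have hval : 0 ≤ v (c⁻¹ * e.repr y k) := by
        have hk := hy k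
        rw [show e.repr y k = c * (c⁻¹ * e.repr y k) by field_simp, v.map_mul, ← hn] at hk
        generalize v (c⁻¹ * e.repr y k) = w at hk ⊢
        cases w with
        | top => simp
        | coe w =>
          norm_cast at hk ⊢
          omega
      simp only [f, LinearMap.smulRight_apply, Module.Basis.coord_apply, map_smul,
        Finsupp.smul_apply, smul_eq_mul, v.map_mul (e.repr x i)]
      exact add_nonneg ((he x).mp hx i) hval
    rw [h] at hf
    have hj : e' j ∈ L' := by
      rw [he']
      intro k
      rw [e'.repr_self, Finsupp.single_apply]
      split_ifs <;> simp
    have hfj := hf (e' j) hj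
    rwa [LinearMap.toMatrix'_mulVec, LinearMap.smulRight_apply, Module.Basis.coord_apply, ← hc,
      smul_inv_smul₀ hc0] at hfj
end

section
/- Let M = (m_ij) ∈ ℤ^{d×d} satisfy m_ii = 0 for all i and m_ik ≤ m_ij + m_jk for all i, j, k, and let u, u' ∈ ℤ^d satisfy u_i − u_j ≤ m_ij and u'_i − u'_j ≤ m_ij for all i, j. Then the diagonal lattices L_u and L_{u'}, regarded as modules over the ring Λ_M via matrix-vector multiplication, are isomorphic as Λ_M-modules if and only if u' − u ∈ ℤ·(1,1,…,1), i.e., L_{u'} = p^n L_u for some n ∈ ℤ. -/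
set_option synthInstance.maxHeartbeats 400000
set_option maxHeartbeats 1600000

open scoped Pointwise

/-- The set `I_N = {X ∈ K^{d×d} : val(X) ≥ N}` (equal to `Λ_N` for suitable `N`). -/
def matSet {K : Type*} [Field K] (v : AddValuation K (WithTop ℤ)) {d : ℕ}
    (N : Matrix (Fin d) (Fin d) ℤ) : Set (Matrix (Fin d) (Fin d) K) :=
  {X | ∀ i j, (N i j : WithTop ℤ) ≤ v (X i j)}

/-- The diagonal lattice `L_u = {x ∈ K^d : val(x_i) ≥ u_i}` as a set. -/
def latSet {K : Type*} [Field K] (v : AddValuation K (WithTop ℤ)) {d : ℕ}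
    (u : Fin d → ℤ) : Set (Fin d → K) :=
  {x | ∀ i, (u i : WithTop ℤ) ≤ v (x i)}

/-- The diagonal lattice `L_u` as an `O_K`-submodule of `K^d`. -/
def latSub {K : Type*} [Field K] (v : AddValuation K (WithTop ℤ)) {d : ℕ}
    (u : Fin d → ℤ) : Submodule (valRing v) (Fin d → K) where
  carrier := latSet v u
  zero_mem' := fun i => by simp only [Pi.zero_apply, v.map_zero]; exact le_top
  add_mem' := fun {x y} hx hy i => v.map_le_add (hx i) (hy i)
  smul_mem' := fun c x hx i => by
    have hc : (0 : WithTop ℤ) ≤ v (c : K) := c.2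
    have hcx : (c • x) i = (c : K) * x i := rfl
    rw [hcx, v.map_mul]
    calc ((u i : ℤ) : WithTop ℤ) = 0 + (u i : ℤ) := by rw [zero_add]
      _ ≤ v (c : K) + v (x i) := add_le_add hc (hx i)

theorem exists_ne_zero_valuation_eq {K : Type*} [Field K]
    (v : AddValuation K (WithTop ℤ)) (hv : Function.Surjective v) (n : ℤ) :
    ∃ t : K, t ≠ 0 ∧ v t = n := by
  obtain ⟨t, ht⟩ := hv n
  refine ⟨t, ?_, ht⟩
  rintro rfl
  rw [v.map_zero] at ht
  exact WithTop.top_ne_coe ht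

theorem single_mem_matSet {K : Type*} [Field K] (v : AddValuation K (WithTop ℤ)) {d : ℕ}
    {M : Matrix (Fin d) (Fin d) ℤ} {i j : Fin d} {c : K} (hc : (M i j : WithTop ℤ) ≤ v c) :
    Matrix.single i j c ∈ matSet v M := by
  intro k l
  by_cases h : i = k ∧ j = l
  · obtain ⟨rfl, rfl⟩ := h
    simpa using hc
  · rw [Matrix.single_apply, if_neg h, v.map_zero]
    exact le_top

theorem single_mem_latSub {K : Type*} [Field K] (v : AddValuation K (WithTop ℤ)) {d : ℕ}
    {u : Fin d → ℤ} {i : Fin d} {c : K} (hc : (u i : WithTop ℤ) ≤ v c) :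
    Pi.single i c ∈ latSub v u := by
  intro k
  by_cases h : k = i
  · subst h
    simpa using hc
  · rw [Pi.single_eq_of_ne h, v.map_zero]
    exact le_top

/-- A map between diagonal lattices commuting with `Λ_M` is proportional to the inclusion. -/
theorem apply_mul_comm_of_equivariant {K : Type*} [Field K]
    (v : AddValuation K (WithTop ℤ)) (hv : Function.Surjective v) {d : ℕ}
    (M : Matrix (Fin d) (Fin d) ℤ) (hdiag : ∀ i, M i i = 0)
    (u u' : Fin d → ℤ) (hu : ∀ i j, u i - u j ≤ M i j)
    (e : latSub v u → latSub v u')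
    (he : ∀ X ∈ matSet v M, ∀ x y : latSub v u,
      (y : Fin d → K) = X.mulVec (x : Fin d → K) →
      (e y : Fin d → K) = X.mulVec (e x : Fin d → K))
    (x y : latSub v u) (i j : Fin d) :
    (x : Fin d → K) i * (e y : Fin d → K) j = (y : Fin d → K) j * (e x : Fin d → K) i := by
  obtain ⟨w, hw0, hw⟩ := exists_ne_zero_valuation_eq v hv (max (M i j - u i) (- u j))
  have hx : (u i : WithTop ℤ) ≤ v ((x : Fin d → K) i) := x.2 i
  have hy : (u j : WithTop ℤ) ≤ v ((y : Fin d → K) j) := y.2 j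
  have hwx : (M i j : WithTop ℤ) ≤ v (w * (x : Fin d → K) i) := by
    rw [v.map_mul, hw]
    refine le_trans ?_ (add_le_add_right hx _)
    norm_cast
    omega
  have hwy : (M i i : WithTop ℤ) ≤ v (w * (y : Fin d → K) j) := by
    rw [v.map_mul, hw, hdiag]
    refine le_trans ?_ (add_le_add_right hy _)
    norm_cast
    omega
  have hz : (u i : WithTop ℤ) ≤ v (w * (x : Fin d → K) i * (y : Fin d → K) j) := by
    rw [v.map_mul]
    refine le_trans ?_ (add_le_add hwx hy)
    have := hu i j
    norm_cast
    omega
  let z : latSub v u := ⟨_, single_mem_latSub v hz⟩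
  have h₁ := he _ (single_mem_matSet v hwx) y z
    (by simp [z, Matrix.single_mulVec_eq, ← Pi.single_smul])
  have h₂ := he _ (single_mem_matSet v hwy) x z
    (by simp [z, Matrix.single_mulVec_eq, ← Pi.single_smul, mul_right_comm])
  have h := congrFun (h₁.symm.trans h₂) i
  simp only [Matrix.single_mulVec_eq, Pi.smul_apply, Pi.single_eq_same, smul_eq_mul, mul_one,
    mul_assoc] at h
  exact mul_left_cancel₀ hw0 h

theorem smul_mem_latSub_iff {K : Type*} [Field K] (v : AddValuation K (WithTop ℤ)) {d : ℕ}
    {u u' : Fin d → ℤ} {n : ℤ} (hn : ∀ i, u' i = u i + n) {t : K} (ht : v t = n)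
    (x : Fin d → K) : t • x ∈ latSub v u' ↔ x ∈ latSub v u := by
  refine forall_congr' fun i => ?_
  rw [hn, Pi.smul_apply, smul_eq_mul, v.map_mul, ht, add_comm (u i), WithTop.coe_add]
  exact WithTop.add_le_add_iff_left WithTop.coe_ne_top

/-- Multiplication by `t` as an isomorphism of diagonal lattices. -/
def latSubSMulEquiv {K : Type*} [Field K] (v : AddValuation K (WithTop ℤ)) {d : ℕ}
    {u u' : Fin d → ℤ} {n : ℤ} (hn : ∀ i, u' i = u i + n) {t : K} (ht0 : t ≠ 0) (ht : v t = n) :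
    latSub v u ≃ₗ[valRing v] latSub v u' where
  toFun x := ⟨t • (x : Fin d → K), (smul_mem_latSub_iff v hn ht _).2 x.2⟩
  map_add' x y := Subtype.ext (smul_add t (x : Fin d → K) y)
  map_smul' c x := Subtype.ext (smul_comm t (c : K) (x : Fin d → K))
  invFun x := ⟨t⁻¹ • (x : Fin d → K), (smul_mem_latSub_iff v hn ht _).1 <| by
    rw [smul_inv_smul₀ ht0]
    exact x.2⟩
  left_inv x := Subtype.ext (inv_smul_smul₀ ht0 (x : Fin d → K))
  right_inv x := Subtype.ext (smul_inv_smul₀ ht0 (x : Fin d → K))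

/-- For a graduated order `Λ_M` and `u, u'` with `u_i - u_j ≤ m_ij` and
`u'_i - u'_j ≤ m_ij`, the diagonal lattices `L_u` and `L_{u'}` are isomorphic as
`Λ_M`-modules (an `O_K`-linear equivalence commuting with the action of every `X ∈ Λ_M`)
if and only if `u' - u ∈ ℤ·(1,…,1)`. -/
theorem diagonal_lattices_isomorphic_iff {K : Type*} [Field K]
    (v : AddValuation K (WithTop ℤ)) (hv : Function.Surjective v)
    (d : ℕ) (hd : 0 < d)
    (M : Matrix (Fin d) (Fin d) ℤ) (hdiag : ∀ i, M i i = 0)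
    (htri : ∀ i j k, M i k ≤ M i j + M j k)
    (u u' : Fin d → ℤ)
    (hu : ∀ i j, u i - u j ≤ M i j) (hu' : ∀ i j, u' i - u' j ≤ M i j) :
    (∃ e : latSub v u ≃ₗ[valRing v] latSub v u',
        ∀ X ∈ matSet v M, ∀ x y : latSub v u,
          (y : Fin d → K) = X.mulVec (x : Fin d → K) →
          (e y : Fin d → K) = X.mulVec (e x : Fin d → K)) ↔
      ∃ n : ℤ, ∀ i, u' i = u i + n := by
  constructor
  · rintro ⟨e, he⟩
    choose t ht0 ht using exists_ne_zero_valuation_eq v hv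
    let f : latSub v u := ⟨fun i => t (u i), fun i => (ht _).ge⟩
    let g : latSub v u' := ⟨fun i => t (u' i), fun i => (ht _).ge⟩
    let i₀ : Fin d := ⟨0, hd⟩
    obtain ⟨γ, hγ⟩ : ∃ γ : K, ∀ (x : latSub v u) (i : Fin d),
        (e x : Fin d → K) i = γ * (x : Fin d → K) i := by
      refine ⟨(e f : Fin d → K) i₀ / t (u i₀), fun x i => ?_⟩
      have h := apply_mul_comm_of_equivariant v hv M hdiag u u' hu e he x f i i₀
      rw [div_mul_eq_mul_div, eq_div_iff (ht0 _), mul_comm, mul_comm _ ((x : Fin d → K) i)]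
      exact h.symm
    have hg (i : Fin d) : t (u' i) = γ * (e.symm g : Fin d → K) i := by
      rw [← hγ, e.apply_symm_apply]
    have hγ0 : γ ≠ 0 := by
      rintro rfl
      exact ht0 _ ((hg i₀).trans (zero_mul _))
    obtain ⟨n, hn⟩ := WithTop.ne_top_iff_exists.1 (mt v.top_iff.1 hγ0)
    refine ⟨n, fun i => le_antisymm ?_ ?_⟩
    · have h : (u' i : WithTop ℤ) ≤ v ((e f : Fin d → K) i) := (e f).2 i
      rw [hγ, v.map_mul, ← hn, show v ((f : Fin d → K) i) = u i from ht _] at h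
      norm_cast at h
      omega
    · have h : (u i : WithTop ℤ) ≤ v ((e.symm g : Fin d → K) i) := (e.symm g).2 i
      have h' := add_le_add_right h (v γ)
      rw [← v.map_mul, ← hg, ht, ← hn] at h'
      norm_cast at h'
      omega
  · rintro ⟨n, hn⟩
    obtain ⟨t, ht0, ht⟩ := exists_ne_zero_valuation_eq v hv n
    refine ⟨latSubSMulEquiv v hn ht0 ht, fun X _ x y hxy => ?_⟩
    change t • (y : Fin d → K) = X.mulVec (t • (x : Fin d → K))
    rw [hxy, Matrix.mulVec_smul]
end

section
/- Let M = (m_ij) ∈ ℤ^{d×d} satisfy m_ii = 0, m_ik ≤ m_ij + m_jk for all i, j, k, and be in standard form (m_ij ≥ 0 for all i, j and m_ij + m_ji > 0 for i ≠ j). A subset J ⊆ K^{d×d} is a fractional ideal of Λ_M if and only if J = I_N for some matrix N = (n_ij) ∈ ℤ^{d×d} satisfying n_ik ≤ n_ij + m_jk and n_ik ≤ m_ij + n_jk for all 1 ≤ i, j, k ≤ d (equivalently, N ⊙ M = M ⊙ N = N in the min-plus algebra). -/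
set_option synthInstance.maxHeartbeats 400000
set_option maxHeartbeats 1600000

open scoped Pointwise

/-- A fractional ideal of the graduated order `Λ_M`: a nonzero additive subgroup `J`
of `K^{d×d}` with `Λ_M · J ⊆ J`, `J · Λ_M ⊆ J` and `α · J ⊆ Λ_M` for some `α ∈ Kˣ`. -/
def isFracIdeal {K : Type*} [Field K] (v : AddValuation K (WithTop ℤ)) {d : ℕ}
    (M : Matrix (Fin d) (Fin d) ℤ) (J : Set (Matrix (Fin d) (Fin d) K)) : Prop :=
  (0 : Matrix (Fin d) (Fin d) K) ∈ J ∧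
  (∀ X ∈ J, ∀ Y ∈ J, X + Y ∈ J) ∧
  (∀ X ∈ J, -X ∈ J) ∧
  J ≠ {0} ∧
  (∀ A ∈ matSet v M, ∀ X ∈ J, A * X ∈ J ∧ X * A ∈ J) ∧
  ∃ α : K, α ≠ 0 ∧ ∀ X ∈ J, α • X ∈ matSet v M

section GraduatedOrder

variable {K : Type*} [Field K] {v : AddValuation K (WithTop ℤ)} {d : ℕ}
  {L M N : Matrix (Fin d) (Fin d) ℤ} {J : Set (Matrix (Fin d) (Fin d) K)}

theorem single_mem_matSet_iff {i j : Fin d} {c : K} :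
    Matrix.single i j c ∈ matSet v N ↔ (N i j : WithTop ℤ) ≤ v c := by
  refine ⟨fun h => by simpa using h i j, fun h k l => ?_⟩
  by_cases hkl : i = k ∧ j = l
  · obtain ⟨rfl, rfl⟩ := hkl
    simpa using h
  · simp [hkl]

theorem mul_mem_matSet (h : ∀ i j k, N i k ≤ L i j + M j k)
    {X Y : Matrix (Fin d) (Fin d) K} (hX : X ∈ matSet v L) (hY : Y ∈ matSet v M) :
    X * Y ∈ matSet v N := by
  intro i k
  rw [Matrix.mul_apply]
  refine v.map_le_sum fun j _ => ?_
  rw [v.map_mul]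
  calc (N i k : WithTop ℤ) ≤ ((L i j + M j k : ℤ) : WithTop ℤ) := by exact_mod_cast h i j k
    _ = (L i j : WithTop ℤ) + (M j k : WithTop ℤ) := by push_cast; rfl
    _ ≤ _ := add_le_add (hX i j) (hY j k)

theorem single_mul_mul_single (X : Matrix (Fin d) (Fin d) K) (i k l j : Fin d) (a b : K) :
    Matrix.single i k a * X * Matrix.single l j b = Matrix.single i j (a * X k l * b) := by
  ext r s
  simp only [Matrix.mul_apply, Matrix.single_apply]
  by_cases hr : i = r <;> by_cases hs : j = s <;> simp [hr, hs]

theorem exists_ne_zero_smul_mem_matSet (hv : Function.Surjective v)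
    (M N : Matrix (Fin d) (Fin d) ℤ) :
    ∃ α : K, α ≠ 0 ∧ ∀ X ∈ matSet v N, α • X ∈ matSet v M := by
  obtain ⟨t, ht⟩ : ∃ t : ℤ, ∀ p : Fin d × Fin d, M p.1 p.2 - N p.1 p.2 ≤ t := by
    obtain ⟨t, ht⟩ := (Set.finite_range fun p : Fin d × Fin d => M p.1 p.2 - N p.1 p.2).bddAbove
    exact ⟨t, fun p => ht ⟨p, rfl⟩⟩
  obtain ⟨α, hα⟩ := hv (t : WithTop ℤ)
  refine ⟨α, fun h => by simp [h] at hα, fun X hX i j => ?_⟩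
  rw [Matrix.smul_apply, smul_eq_mul, v.map_mul, hα]
  calc (M i j : WithTop ℤ) ≤ ((t + N i j : ℤ) : WithTop ℤ) := by
        have := ht (i, j)
        exact_mod_cast (by simp only at this; omega : M i j ≤ t + N i j)
    _ = (t : WithTop ℤ) + (N i j : WithTop ℤ) := by push_cast; rfl
    _ ≤ _ := by gcongr; exact hX i j

theorem isFracIdeal_matSet (hv : Function.Surjective v) (hd : 0 < d)
    (hN : ∀ i j k, N i k ≤ N i j + M j k ∧ N i k ≤ M i j + N j k) :
    isFracIdeal v M (matSet v N) := by
  refine ⟨fun i j => by simp, fun X hX Y hY i j => v.map_le_add (hX i j) (hY i j),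
    fun X hX i j => by simpa using hX i j, fun h => ?_,
    fun A hA X hX => ⟨mul_mem_matSet (fun i j k => (hN i j k).2) hA hX,
      mul_mem_matSet (fun i j k => (hN i j k).1) hX hA⟩,
    exists_ne_zero_smul_mem_matSet hv M N⟩
  let o : Fin d := ⟨0, hd⟩
  obtain ⟨c, hc⟩ := hv (N o o : WithTop ℤ)
  have hmem : Matrix.single o o c ∈ matSet v N := single_mem_matSet_iff.2 hc.ge
  rw [h, Set.mem_singleton_iff] at hmem
  have hc0 : c = 0 := by simpa using congrFun₂ hmem o o
  simp [hc0] at hc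

theorem isFracIdeal.single_mem (hJ : isFracIdeal v M J) {X : Matrix (Fin d) (Fin d) K}
    (hX : X ∈ J) {i j k l : Fin d} {a b : K} (ha : (M i k : WithTop ℤ) ≤ v a)
    (hb : (M l j : WithTop ℤ) ≤ v b) : Matrix.single i j (a * X k l * b) ∈ J := by
  obtain ⟨-, -, -, -, hmul, -⟩ := hJ
  rw [← single_mul_mul_single]
  exact (hmul _ (single_mem_matSet_iff.2 hb) _ (hmul _ (single_mem_matSet_iff.2 ha) X hX).1).2

theorem isFracIdeal.exists_isLeast (hv : Function.Surjective v) (hJ : isFracIdeal v M J)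
    (i j : Fin d) :
    ∃ n : ℤ, (∃ X ∈ J, v (X i j) = n) ∧ ∀ X ∈ J, (n : WithTop ℤ) ≤ v (X i j) := by
  obtain ⟨h0, -, -, hne, -, α, hα, hbdd⟩ := id hJ
  have hbelow : ∃ b : ℤ, ∀ n : ℤ, (∃ X ∈ J, v (X i j) = n) → b ≤ n := by
    obtain ⟨t, ht⟩ := WithTop.ne_top_iff_exists.1 (v.ne_top_iff.2 hα)
    refine ⟨M i j - t, fun n ⟨X, hX, hn⟩ => ?_⟩
    have := hbdd X hX i j
    rw [Matrix.smul_apply, smul_eq_mul, v.map_mul, hn, ← ht] at this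
    have : M i j ≤ t + n := by exact_mod_cast this
    omega
  have hex : ∃ n : ℤ, ∃ X ∈ J, v (X i j) = n := by
    obtain ⟨X, hX, hX0⟩ : ∃ X ∈ J, X ≠ 0 := by
      by_contra! h
      exact hne (Set.eq_singleton_iff_unique_mem.2 ⟨h0, h⟩)
    obtain ⟨k, l, hkl⟩ : ∃ k l, X k l ≠ 0 := by
      by_contra! h
      exact hX0 (Matrix.ext h)
    obtain ⟨a, ha⟩ := hv (M i k : WithTop ℤ)
    obtain ⟨b, hb⟩ := hv (M l j : WithTop ℤ)
    obtain ⟨t, ht⟩ := WithTop.ne_top_iff_exists.1 (v.ne_top_iff.2 hkl)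
    refine ⟨M i k + t + M l j, _, hJ.single_mem hX ha.ge hb.ge, ?_⟩
    rw [Matrix.single_apply_same, v.map_mul, v.map_mul, ha, hb, ← ht]
    push_cast
    rfl
  obtain ⟨n, hn, hmin⟩ := Int.exists_least_of_bdd hbelow hex
  refine ⟨n, hn, fun X hX => ?_⟩
  by_cases htop : v (X i j) = ⊤
  · simp [htop]
  · obtain ⟨m, hm⟩ := WithTop.ne_top_iff_exists.1 htop
    rw [← hm]
    exact_mod_cast hmin m ⟨X, hX, hm.symm⟩

theorem isFracIdeal.exists_eq_matSet (hv : Function.Surjective v) (hdiag : ∀ i, M i i = 0)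
    (hJ : isFracIdeal v M J) :
    ∃ N : Matrix (Fin d) (Fin d) ℤ,
      (∀ i j k, N i k ≤ N i j + M j k ∧ N i k ≤ M i j + N j k) ∧ J = matSet v N := by
  choose N hN hmin using fun i j => hJ.exists_isLeast hv i j
  have hone (i : Fin d) : (M i i : WithTop ℤ) ≤ v 1 := by simp [hdiag]
  refine ⟨N, fun i j k => ⟨?_, ?_⟩, Set.Subset.antisymm (fun X hX i j => hmin i j X hX) ?_⟩
  · obtain ⟨X, hX, hXN⟩ := hN i j
    obtain ⟨b, hb⟩ := hv (M j k : WithTop ℤ)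
    have := hmin i k _ (hJ.single_mem hX (hone i) hb.ge)
    rw [Matrix.single_apply_same, one_mul, v.map_mul, hXN, hb] at this
    exact_mod_cast this
  · obtain ⟨X, hX, hXN⟩ := hN j k
    obtain ⟨a, ha⟩ := hv (M i j : WithTop ℤ)
    have := hmin i k _ (hJ.single_mem hX ha.ge (hone k))
    rw [Matrix.single_apply_same, mul_one, v.map_mul, hXN, ha] at this
    exact_mod_cast this
  · intro X hX
    let S : AddSubmonoid (Matrix (Fin d) (Fin d) K) :=
      { carrier := J, zero_mem' := hJ.1, add_mem' := fun {X Y} hX hY => hJ.2.1 X hX Y hY }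
    change X ∈ S
    rw [Matrix.matrix_eq_sum_single X]
    refine sum_mem fun i _ => sum_mem fun j _ => ?_
    obtain ⟨Y, hY, hYN⟩ := hN i j
    have hY0 : Y i j ≠ 0 := fun h => by simp [h] at hYN
    have hquot : (M i i : WithTop ℤ) ≤ v (X i j / Y i j) := by
      have hle : (N i j : WithTop ℤ) ≤ v (X i j / Y i j) + N i j := by
        rw [← hYN, ← v.map_mul, div_mul_cancel₀ _ hY0, hYN]
        exact hX i j
      rw [hdiag]
      generalize v (X i j / Y i j) = w at hle
      induction w with
      | top => exact le_top
      | coe w =>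
        have : N i j ≤ w + N i j := by exact_mod_cast hle
        exact_mod_cast (by omega : 0 ≤ w)
    have := hJ.single_mem hY hquot (hone j)
    rwa [div_mul_cancel₀ _ hY0, mul_one] at this

end GraduatedOrder

/-- Let `M` be a graduated-order matrix in standard form. A subset
`J ⊆ K^{d×d}` is a fractional ideal of `Λ_M` if and only if `J = I_N` for some integer
matrix `N` with `n_ik ≤ n_ij + m_jk` and `n_ik ≤ m_ij + n_jk` for all `i, j, k`. -/
theorem fractional_ideal_iff {K : Type*} [Field K]
    (v : AddValuation K (WithTop ℤ)) (hv : Function.Surjective v)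
    (d : ℕ) (hd : 0 < d)
    (M : Matrix (Fin d) (Fin d) ℤ) (hdiag : ∀ i, M i i = 0)
    (htri : ∀ i j k, M i k ≤ M i j + M j k)
    (hstd1 : ∀ i j, 0 ≤ M i j) (hstd2 : ∀ i j, i ≠ j → 0 < M i j + M j i)
    (J : Set (Matrix (Fin d) (Fin d) K)) :
    isFracIdeal v M J ↔
      ∃ N : Matrix (Fin d) (Fin d) ℤ,
        (∀ i j k, N i k ≤ N i j + M j k ∧ N i k ≤ M i j + N j k) ∧
        J = matSet v N := by
  refine ⟨fun hJ => hJ.exists_eq_matSet hv hdiag, ?_⟩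
  rintro ⟨N, hN, rfl⟩
  exact isFracIdeal_matSet hv hd hN
end
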